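/- Let u, d, m be positive integers with u/(2d) ≥ e^{27} and δ := sqrt( u·ln(u/(2d)) / (9m) ) ≤ 1/2. Throw m balls independently and uniformly at random into u bins, and let b_i denote the number of balls in bin i. Then with probability at least 1/8 there exist at least d distinct indices i ∈ [u] with b_i ≤ (m/u)·(1 − δ). -/

import Mathlib

open Finset

/-- Number of balls in bin `i` when the throws are given by `S`. -/
def occ {u m : ℕ} (S : Fin m → Fin u) (i : Fin u) : ℕ :=
  (Finset.univ.filter (fun j => S j = i)).card

/-- The expectation of `f` under the binomial distribution with `m` trials of success
probability `p`, by recursion on the first trial. -/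
noncomputable def binomExp (p : ℝ) : ℕ → (ℕ → ℝ) → ℝ
  | 0, f => f 0
  | m + 1, f => p * binomExp p m (fun k => f (k + 1)) + (1 - p) * binomExp p m f

theorem binomExp_mono {p : ℝ} (hp0 : 0 ≤ p) (hp1 : p ≤ 1) (m : ℕ) {f g : ℕ → ℝ}
    (h : ∀ k, f k ≤ g k) : binomExp p m f ≤ binomExp p m g := by
  induction m generalizing f g with
  | zero => exact h 0
  | succ m ih =>
    have h1 := mul_le_mul_of_nonneg_left (ih (fun k => h (k + 1))) hp0
    have h2 := mul_le_mul_of_nonneg_left (ih h) (sub_nonneg.2 hp1)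
    simp only [binomExp]
    linarith

theorem binomExp_const (p : ℝ) (m : ℕ) (c : ℝ) : binomExp p m (fun _ => c) = c := by
  induction m with
  | zero => rfl
  | succ m ih => simp only [binomExp, ih]; ring

theorem binomExp_nonneg {p : ℝ} (hp0 : 0 ≤ p) (hp1 : p ≤ 1) (m : ℕ) {f : ℕ → ℝ}
    (h : ∀ k, 0 ≤ f k) : 0 ≤ binomExp p m f :=
  (binomExp_const p m 0).symm.le.trans (binomExp_mono hp0 hp1 m h)

theorem binomExp_quadratic (p : ℝ) (m : ℕ) (a b c : ℝ) :
    binomExp p m (fun k => a + b * ((k : ℝ) - c) ^ 2) =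
      a + b * (m * p * (1 - p) + (m * p - c) ^ 2) := by
  induction m generalizing c with
  | zero => simp [binomExp]
  | succ m ih =>
    have h : (fun k : ℕ => a + b * (((k + 1 : ℕ) : ℝ) - c) ^ 2) =
        fun k : ℕ => a + b * ((k : ℝ) - (c - 1)) ^ 2 := by
      funext k; push_cast; ring
    simp only [binomExp]
    rw [h, ih, ih]
    push_cast
    ring

/-- Cauchy–Schwarz for the change of success probability from `p` to `q`. -/
theorem sq_binomExp_le {p q : ℝ} (hp0 : 0 < p) (hp1 : p < 1) (m : ℕ) (f : ℕ → ℝ) :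
    binomExp q m f ^ 2 ≤
      (1 + (p - q) ^ 2 / (p * (1 - p))) ^ m * binomExp p m (fun k => f k ^ 2) := by
  induction m generalizing f with
  | zero => simp [binomExp]
  | succ m ih =>
    have hp1' : 0 < 1 - p := sub_pos.2 hp1
    have h1 := ih (fun k => f (k + 1))
    have h2 := ih f
    simp only [binomExp]
    set χ := 1 + (p - q) ^ 2 / (p * (1 - p)) with hχ
    set a := binomExp q m (fun k => f (k + 1))
    set b := binomExp q m f
    set A := binomExp p m (fun k => f (k + 1) ^ 2)
    set B := binomExp p m (fun k => f k ^ 2)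
    have hχ0 : 0 ≤ χ := by positivity
    have key : (q * a + (1 - q) * b) ^ 2 ≤ χ * (p * a ^ 2 + (1 - p) * b ^ 2) := by
      have : χ * (p * a ^ 2 + (1 - p) * b ^ 2) - (q * a + (1 - q) * b) ^ 2 =
          (q * (1 - p) * b - (1 - q) * p * a) ^ 2 / (p * (1 - p)) := by
        rw [hχ]; field_simp; ring
      have h0 : 0 ≤ (q * (1 - p) * b - (1 - q) * p * a) ^ 2 / (p * (1 - p)) := by positivity
      linarith
    calc _ ≤ χ * (p * a ^ 2 + (1 - p) * b ^ 2) := key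
      _ ≤ χ * (p * (χ ^ m * A) + (1 - p) * (χ ^ m * B)) := by gcongr
      _ = _ := by ring

theorem occ_cons {u m : ℕ} (a i : Fin u) (S : Fin m → Fin u) :
    occ (Fin.cons a S : Fin (m + 1) → Fin u) i = if a = i then occ S i + 1 else occ S i := by
  unfold occ
  simp only [Finset.card_filter, Fin.sum_univ_succ, Fin.cons_zero, Fin.cons_succ]
  split_ifs <;> omega

theorem sum_fin_succ_fun {u m : ℕ} (F : (Fin (m + 1) → Fin u) → ℝ) :
    ∑ S, F S = ∑ a, ∑ S : Fin m → Fin u, F (Fin.cons a S) := by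
  rw [← Fintype.sum_prod_type']
  exact (Fintype.sum_equiv (Fin.consEquiv fun _ => Fin u) _ _ fun _ => rfl).symm

theorem sum_occ {u : ℕ} (hu : 0 < u) (m : ℕ) (i : Fin u) (f : ℕ → ℝ) :
    ∑ S : Fin m → Fin u, f (occ S i) = (u : ℝ) ^ m * binomExp (1 / u) m f := by
  have hu' : (u : ℝ) ≠ 0 := by positivity
  induction m generalizing f with
  | zero => simp [occ, binomExp]
  | succ m ih =>
    have h (a : Fin u) : ∑ S : Fin m → Fin u, f (occ (Fin.cons a S : Fin (m + 1) → Fin u) i) =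
        ∑ S : Fin m → Fin u, f (occ S i) + if a = i then
          ∑ S : Fin m → Fin u, f (occ S i + 1) - ∑ S : Fin m → Fin u, f (occ S i) else 0 := by
      simp only [occ_cons]
      split_ifs <;> simp
    rw [sum_fin_succ_fun, Finset.sum_congr rfl fun a _ => h a, Finset.sum_add_distrib, ih,
      ih fun k => f (k + 1)]
    simp only [Finset.sum_const, Finset.sum_ite_eq', Finset.mem_univ, if_true,
      Finset.card_univ, Fintype.card_fin, nsmul_eq_mul, binomExp]
    field_simp
    ring

/-- The loads of two distinct bins are negatively correlated. -/
theorem sum_occ_mul_occ_le {u : ℕ} (hu : 2 ≤ u) (m : ℕ) {i j : Fin u} (hij : i ≠ j)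
    {f g : ℕ → ℝ} (hf : Antitone f) (hg : Antitone g) :
    ∑ S : Fin m → Fin u, f (occ S i) * g (occ S j) ≤
      (u : ℝ) ^ m * (binomExp (1 / u) m f * binomExp (1 / u) m g) := by
  have hu2 : (2 : ℝ) ≤ u := by exact_mod_cast hu
  have hu0 : (0 : ℝ) < u := by linarith
  have hp0 : (0 : ℝ) ≤ 1 / u := by positivity
  have hp1 : (1 : ℝ) / u ≤ 1 := by rw [div_le_one hu0]; linarith
  induction m generalizing f g with
  | zero => simp [occ, binomExp]
  | succ m ih =>
    have hf' : Antitone fun k => f (k + 1) := fun _ _ h => hf (by omega)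
    have hg' : Antitone fun k => g (k + 1) := fun _ _ h => hg (by omega)
    have h (a : Fin u) : ∑ S : Fin m → Fin u,
          f (occ (Fin.cons a S : Fin (m + 1) → Fin u) i) *
            g (occ (Fin.cons a S : Fin (m + 1) → Fin u) j) =
        ∑ S : Fin m → Fin u, f (occ S i) * g (occ S j) +
        (if a = i then ∑ S : Fin m → Fin u, f (occ S i + 1) * g (occ S j) -
          ∑ S : Fin m → Fin u, f (occ S i) * g (occ S j) else 0) +
        (if a = j then ∑ S : Fin m → Fin u, f (occ S i) * g (occ S j + 1) -
          ∑ S : Fin m → Fin u, f (occ S i) * g (occ S j) else 0) := by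
      simp only [occ_cons]
      by_cases hi : a = i
      · subst hi; simp [hij]
      · by_cases hj : a = j
        · subst hj; simp [hi]
        · simp [hi, hj]
    have h1 := ih hf' hg
    have h2 := ih hf hg'
    have h3 := mul_le_mul_of_nonneg_left (ih hf hg) (sub_nonneg.2 hu2)
    have hF : binomExp (1 / u) m (fun k => f (k + 1)) ≤ binomExp (1 / u) m f :=
      binomExp_mono hp0 hp1 m fun k => hf (Nat.le_succ k)
    have hG : binomExp (1 / u) m (fun k => g (k + 1)) ≤ binomExp (1 / u) m g :=
      binomExp_mono hp0 hp1 m fun k => hg (Nat.le_succ k)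
    rw [sum_fin_succ_fun, Finset.sum_congr rfl fun a _ => h a, Finset.sum_add_distrib,
      Finset.sum_add_distrib]
    simp only [Finset.sum_const, Finset.sum_ite_eq', Finset.mem_univ, if_true,
      Finset.card_univ, Fintype.card_fin, nsmul_eq_mul, binomExp]
    set F := binomExp (1 / u) m f
    set F' := binomExp (1 / u) m (fun k => f (k + 1))
    set G := binomExp (1 / u) m g
    set G' := binomExp (1 / u) m (fun k => g (k + 1))
    have key : (u : ℝ) ^ (m + 1) *
        ((1 / u * F' + (1 - 1 / u) * F) * (1 / u * G' + (1 - 1 / u) * G)) =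
        (u : ℝ) ^ m * (F' * G) + (u : ℝ) ^ m * (F * G') + (u - 2) * ((u : ℝ) ^ m * (F * G)) +
          (u : ℝ) ^ m / u * ((F - F') * (G - G')) := by
      field_simp
      ring
    have h0 : 0 ≤ (u : ℝ) ^ m / u * ((F - F') * (G - G')) :=
      mul_nonneg (by positivity) (mul_nonneg (sub_nonneg.2 hF) (sub_nonneg.2 hG))
    rw [key]
    linarith

/-- Lower bound for the lower tail of a binomial distribution of mean `μ = m / u`. -/
theorem exp_neg_le_binomExp_lower_tail {u m : ℕ} (hu : 2 ≤ u) (hm : 0 < m) {δ : ℝ}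
    (hδ0 : 0 < δ) (hδ : δ ≤ 1 / 2) (h3 : 3 ≤ (m : ℝ) / u * δ ^ 2) :
    Real.exp (-(9 * ((m : ℝ) / u * δ ^ 2))) ≤
      binomExp (1 / u) m (fun k => if (k : ℝ) ≤ (m : ℝ) / u * (1 - δ) then 1 else 0) := by
  have hu2 : (2 : ℝ) ≤ u := by exact_mod_cast hu
  have hu0 : (0 : ℝ) < u := by linarith
  have hm0 : (0 : ℝ) < m := by exact_mod_cast hm
  set μ : ℝ := (m : ℝ) / u with hμ
  have hμ0 : 0 < μ := by positivity
  set p : ℝ := 1 / u with hp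
  have hp0 : 0 < p := by positivity
  have hp2 : p ≤ 1 / 2 := by rw [hp]; gcongr
  have hmp : m * p = μ := by rw [hp, hμ]; ring
  set q : ℝ := p * (1 - 2 * δ) with hq
  have hq0 : 0 ≤ q := mul_nonneg hp0.le (by linarith)
  have hq1 : q ≤ 1 := by nlinarith
  have hmq : m * q = μ * (1 - 2 * δ) := by rw [hq, ← hmp]; ring
  set f : ℕ → ℝ := fun k => if (k : ℝ) ≤ μ * (1 - δ) then 1 else 0 with hf
  have hff : (fun k => f k ^ 2) = f := by funext k; simp only [hf]; split_ifs <;> norm_num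
  have hcheb : 2 / 3 ≤ binomExp q m f := by
    have hle : ∀ k : ℕ, 1 + (-(1 / (μ * δ) ^ 2)) * ((k : ℝ) - m * q) ^ 2 ≤ f k := by
      intro k
      have h0 : 0 ≤ 1 / (μ * δ) ^ 2 * ((k : ℝ) - m * q) ^ 2 := by positivity
      simp only [hf]
      split_ifs with hk
      · linarith
      · have : μ * δ ≤ (k : ℝ) - m * q := by rw [hmq]; linarith
        have : (μ * δ) ^ 2 ≤ ((k : ℝ) - m * q) ^ 2 := by gcongr
        have : 1 ≤ 1 / (μ * δ) ^ 2 * ((k : ℝ) - m * q) ^ 2 := by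
          rw [one_div, inv_mul_eq_div, one_le_div (by positivity)]; exact this
        linarith
    have h := binomExp_mono hq0 hq1 m hle
    rw [binomExp_quadratic] at h
    have hvar : m * q * (1 - q) + (m * q - m * q) ^ 2 ≤ μ := by
      rw [hmq]
      nlinarith [mul_nonneg (mul_nonneg hμ0.le (by linarith : 0 ≤ 1 - 2 * δ)) hq0,
        mul_pos hμ0 hδ0]
    have hb : 1 / (μ * δ) ^ 2 * (m * q * (1 - q) + (m * q - m * q) ^ 2) ≤ 1 / 3 :=
      calc _ ≤ 1 / (μ * δ) ^ 2 * μ := by gcongr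
        _ = 1 / (μ * δ ^ 2) := by field_simp
        _ ≤ 1 / 3 := by gcongr
    linarith
  have hCS := sq_binomExp_le (q := q) hp0 (by linarith : p < 1) m f
  rw [hff] at hCS
  have hP0 : 0 ≤ binomExp p m f :=
    binomExp_nonneg hp0.le (by linarith) m fun k => by simp only [hf]; split_ifs <;> norm_num
  set P := binomExp p m f
  set s := μ * δ ^ 2 with hs
  have hχ : (1 + (p - q) ^ 2 / (p * (1 - p))) ^ m ≤ Real.exp (8 * s) := by
    have h1 : (p - q) ^ 2 / (p * (1 - p)) ≤ 8 * p * δ ^ 2 := by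
      have : (p - q) ^ 2 = 4 * p ^ 2 * δ ^ 2 := by rw [hq]; ring
      rw [this, div_le_iff₀ (mul_pos hp0 (by linarith))]
      nlinarith [mul_nonneg (mul_nonneg (sq_nonneg p) (sq_nonneg δ))
        (by linarith : 0 ≤ 1 / 2 - p)]
    have h0 : 0 ≤ (p - q) ^ 2 / (p * (1 - p)) :=
      div_nonneg (sq_nonneg _) (mul_nonneg hp0.le (by linarith))
    calc _ ≤ Real.exp (8 * p * δ ^ 2) ^ m := by
          gcongr
          linarith [Real.add_one_le_exp (8 * p * δ ^ 2)]
      _ = Real.exp (8 * s) := by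
          rw [← Real.exp_nat_mul, hs, ← hmp]; congr 1; ring
  have hmain : 4 / 9 ≤ Real.exp (8 * s) * P :=
    calc (4 : ℝ) / 9 = (2 / 3) ^ 2 := by norm_num
      _ ≤ binomExp q m f ^ 2 := by gcongr
      _ ≤ _ := hCS
      _ ≤ _ := by gcongr
  have hexp : Real.exp (-s) ≤ 4 / 9 := by
    rw [Real.exp_neg, inv_le_comm₀ (Real.exp_pos _) (by norm_num)]
    linarith [Real.add_one_le_exp s]
  calc Real.exp (-(9 * s)) = Real.exp (-(8 * s)) * Real.exp (-s) := by
        rw [← Real.exp_add]; congr 1; ring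
    _ ≤ Real.exp (-(8 * s)) * (Real.exp (8 * s) * P) := by gcongr; linarith
    _ = P := by rw [← mul_assoc, ← Real.exp_add]; simp

/-- Paley–Zygmund at half the mean, for a finite sum with second moment at most `M + M ^ 2`. -/
theorem paley_zygmund_card {α : Type*} [Fintype α] {N : α → ℝ} {M W x : ℝ} (hM : 2 ≤ M)
    (hW : 0 < W) (hcard : (Fintype.card α : ℝ) = W) (hx : 2 * x ≤ M)
    (h1 : ∑ S, N S = W * M) (h2 : ∑ S, N S ^ 2 ≤ W * (M + M ^ 2))
    [DecidablePred fun S => x ≤ N S] :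
    1 / 8 ≤ ((Finset.univ.filter fun S => x ≤ N S).card : ℝ) / W := by
  set A := Finset.univ.filter fun S => x ≤ N S with hA
  have hsplit := Finset.sum_filter_add_sum_filter_not Finset.univ (fun S => x ≤ N S) N
  have hbad : ∑ S with ¬ x ≤ N S, N S ≤ W * (M / 2) :=
    calc _ ≤ ∑ S with ¬ x ≤ N S, M / 2 := by
          refine Finset.sum_le_sum fun S hS => ?_
          have := (Finset.mem_filter.1 hS).2
          linarith
      _ ≤ ∑ _S : α, M / 2 :=
          Finset.sum_le_sum_of_subset_of_nonneg (Finset.filter_subset _ _)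
            fun _ _ _ => by linarith
      _ = W * (M / 2) := by rw [Finset.sum_const, nsmul_eq_mul, Finset.card_univ, hcard]
  have hgood : W * (M / 2) ≤ ∑ S ∈ A, N S := by linarith
  have hCS : (∑ S ∈ A, N S) ^ 2 ≤ A.card * ∑ S ∈ A, N S ^ 2 := sq_sum_le_card_mul_sum_sq
  have hsub : ∑ S ∈ A, N S ^ 2 ≤ W * (M + M ^ 2) :=
    (Finset.sum_le_sum_of_subset_of_nonneg (Finset.filter_subset _ _)
      fun _ _ _ => sq_nonneg _).trans h2
  have hfin : (W * (M / 2)) ^ 2 ≤ A.card * (W * (M + M ^ 2)) :=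
    calc _ ≤ (∑ S ∈ A, N S) ^ 2 := by gcongr
      _ ≤ _ := hCS
      _ ≤ _ := by gcongr
  rw [le_div_iff₀ hW]
  have hWM : 0 < W * (M + M ^ 2) := by positivity
  refine le_of_mul_le_mul_right (le_trans ?_ hfin) hWM
  nlinarith [mul_nonneg (mul_nonneg (sq_nonneg W) (by linarith : 0 ≤ M))
    (by linarith : 0 ≤ M - 1)]

-- STATEMENT 9: with probability at least 1/8, at least `d` bins receive at most
-- `(m/u)(1 - δ)` balls.
open Classical in
theorem many_underloaded_bins (u d m : ℕ) (hu : 0 < u) (hd : 0 < d) (hm : 0 < m)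
    (hratio : Real.exp 27 ≤ (u : ℝ) / (2 * d))
    (δ : ℝ) (hδ : δ = Real.sqrt ((u : ℝ) * Real.log ((u : ℝ) / (2 * d)) / (9 * m)))
    (hδhalf : δ ≤ 1 / 2) :
    (1 : ℝ) / 8 ≤
      ((Finset.univ.filter (fun S : Fin m → Fin u =>
          d ≤ (Finset.univ.filter (fun i : Fin u =>
            (occ S i : ℝ) ≤ ((m : ℝ) / u) * (1 - δ))).card)).card : ℝ) /
        (u : ℝ) ^ m := by
  have hd0 : (1 : ℝ) ≤ d := by exact_mod_cast hd
  have hu0 : (0 : ℝ) < u := by exact_mod_cast hu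
  have hm0 : (0 : ℝ) < m := by exact_mod_cast hm
  have hr0 : 0 < (u : ℝ) / (2 * d) := by positivity
  have hu2 : 2 ≤ u := by
    have h1 : (1 : ℝ) ≤ u / (2 * d) := (Real.one_le_exp (by norm_num)).trans hratio
    rw [one_le_div (by positivity)] at h1
    have : (2 : ℝ) ≤ u := by linarith
    exact_mod_cast this
  set L := Real.log ((u : ℝ) / (2 * d)) with hL
  have hL27 : 27 ≤ L := (Real.le_log_iff_exp_le hr0).2 hratio
  have hsq0 : 0 < (u : ℝ) * L / (9 * m) := by positivity
  have hδ0 : 0 < δ := hδ ▸ Real.sqrt_pos.2 hsq0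
  have hs : 9 * ((m : ℝ) / u * δ ^ 2) = L := by
    rw [hδ, Real.sq_sqrt hsq0.le]; field_simp
  have htail := exp_neg_le_binomExp_lower_tail hu2 hm hδ0 hδhalf (by linarith)
  rw [hs, Real.exp_neg, hL, Real.exp_log hr0, inv_div] at htail
  set f : ℕ → ℝ := fun k => if (k : ℝ) ≤ (m : ℝ) / u * (1 - δ) then 1 else 0 with hf
  have hfanti : Antitone f := by
    intro a b hab
    have : (a : ℝ) ≤ b := by exact_mod_cast hab
    simp only [hf]
    split_ifs <;> linarith
  have hff : ∀ k, f k * f k = f k := fun k => by simp only [hf]; split_ifs <;> norm_num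
  set P := binomExp (1 / u) m f with hP
  have hM : 2 * (d : ℝ) ≤ u * P := by
    rw [div_le_iff₀ hu0] at htail; linarith
  have hN (S : Fin m → Fin u) : ((Finset.univ.filter (fun i : Fin u =>
      (occ S i : ℝ) ≤ ((m : ℝ) / u) * (1 - δ))).card : ℝ) = ∑ i, f (occ S i) := by
    simp [hf]
  have h1 : ∑ S : Fin m → Fin u, ∑ i, f (occ S i) = (u : ℝ) ^ m * (u * P) := by
    rw [Finset.sum_comm]
    simp only [sum_occ hu, Finset.sum_const, Finset.card_univ, Fintype.card_fin, nsmul_eq_mul]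
    ring
  have h2 : ∑ S : Fin m → Fin u, (∑ i, f (occ S i)) ^ 2 ≤
      (u : ℝ) ^ m * (u * P + (u * P) ^ 2) := by
    have hpair (i j : Fin u) : ∑ S : Fin m → Fin u, f (occ S i) * f (occ S j) ≤
        (u : ℝ) ^ m * (P * P) + if i = j then (u : ℝ) ^ m * P else 0 := by
      split_ifs with hij
      · subst hij
        simp only [hff, sum_occ hu]
        have : 0 ≤ (u : ℝ) ^ m * (P * P) := mul_nonneg (by positivity) (mul_self_nonneg P)
        linarith
      · rw [add_zero]
        exact sum_occ_mul_occ_le hu2 m hij hfanti hfanti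
    calc _ = ∑ i, ∑ j, ∑ S : Fin m → Fin u, f (occ S i) * f (occ S j) := by
          simp only [sq, Finset.sum_mul_sum]
          rw [Finset.sum_comm]
          exact Finset.sum_congr rfl fun i _ => Finset.sum_comm
      _ ≤ ∑ i : Fin u, ∑ j : Fin u,
            ((u : ℝ) ^ m * (P * P) + if i = j then (u : ℝ) ^ m * P else 0) :=
          Finset.sum_le_sum fun i _ => Finset.sum_le_sum fun j _ => hpair i j
      _ = _ := by
          simp only [Finset.sum_add_distrib, Finset.sum_const, Finset.sum_ite_eq,
            Finset.mem_univ, if_true, Finset.card_univ, Fintype.card_fin, nsmul_eq_mul]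
          ring
  have hcard : (Fintype.card (Fin m → Fin u) : ℝ) = (u : ℝ) ^ m := by simp
  have hPZ := paley_zygmund_card (by linarith) (by positivity) hcard hM h1 h2
  simpa only [← hN, Nat.cast_le] using hPZ
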